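/- arXiv:2111.00259 — 4 statements merged into one kernel-verified Lean document; each statement's English description precedes it below -/
import Mathlib

section
/- For every binary word x, the abelian border arrays of x and of its complement x̄ coincide: π_x = π_{x̄}. Consequently, every valid abelian border array has exactly two generating words, and they are complements of each other; in particular, each valid abelian border array has a unique generating word whose first letter is 0. -/
/-- Number of ones among positions `a, a+1, …, b-1` (0-indexed) of the binary word `x`. -/
def onesIn (x : ℕ → Bool) (a b : ℕ) : ℕ :=
  ((Finset.Ico a b).filter (fun i => x i = true)).card

/-- The length-`k` prefix of the length-`m` word `x[0..m-1]` is an abelian border of it: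
it is a proper prefix (`k < m`) whose number of ones equals that of the length-`k` suffix. -/
def IsAbelianBorder (x : ℕ → Bool) (m k : ℕ) : Prop :=
  k < m ∧ onesIn x 0 k = onesIn x (m - k) m

/-- `abArray x i` is the length of the longest abelian border of the prefix `x[0..i-1]`
(the entry `π_x[i]` of the abelian border array, in 1-indexed notation). -/
noncomputable def abArray (x : ℕ → Bool) (i : ℕ) : ℕ :=
  sSup {k | IsAbelianBorder x i k}
/-- The abelian border array of a binary word of length `n` given as `x : Fin n → Bool`:
`abVec x i` is the length of the longest abelian border of the prefix of length `i+1`,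
i.e. the entry `π_x[i+1]` in 1-indexed notation. -/
noncomputable def abVec {n : ℕ} (x : Fin n → Bool) : Fin n → ℕ :=
  fun i => abArray (fun j => if h : j < n then x ⟨j, h⟩ else false) (i.1 + 1)

theorem onesIn_add_onesIn_of_eq_not {x y : ℕ → Bool} {a b : ℕ}
    (h : ∀ j < b, y j = !x j) : onesIn x a b + onesIn y a b = b - a := by
  have hy : (Finset.Ico a b).filter (fun i => y i = true) =
      (Finset.Ico a b).filter (fun i => ¬ x i = true) := by
    refine Finset.filter_congr fun i hi => ?_
    rw [h i (Finset.mem_Ico.mp hi).2]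
    simp
  rw [onesIn, onesIn, hy, Finset.card_filter_add_card_filter_not, Nat.card_Ico]

theorem abArray_eq_of_eq_not {x y : ℕ → Bool} {m : ℕ} (h : ∀ j < m, y j = !x j) :
    abArray x m = abArray y m := by
  unfold abArray
  congr 1
  ext k
  refine and_congr_right fun hk => ?_
  have h1 := onesIn_add_onesIn_of_eq_not (a := 0) fun j hj => h j (lt_trans hj hk)
  have h2 := onesIn_add_onesIn_of_eq_not (a := m - k) h
  omega

theorem isAbelianBorder_succ_self_iff (x : ℕ → Bool) (i : ℕ) :
    IsAbelianBorder x (i + 1) i ↔ x 0 = x i := by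
  have h1 : onesIn x 0 (i + 1) = onesIn x 0 i + if x i = true then 1 else 0 := by
    simp only [onesIn, Finset.card_filter]
    exact Finset.sum_Ico_succ_top (Nat.zero_le i) _
  have h2 : onesIn x 0 (i + 1) = (if x 0 = true then 1 else 0) + onesIn x 1 (i + 1) := by
    simp only [onesIn, Finset.card_filter]
    exact Finset.sum_eq_sum_Ico_succ_bot (Nat.succ_pos i) _
  rw [IsAbelianBorder, Nat.add_sub_cancel_left]
  cases h0 : x 0 <;> cases hi : x i <;> simp [h0, hi] at h1 h2 ⊢ <;> omega

theorem isAbelianBorder_abArray_succ (x : ℕ → Bool) (i : ℕ) :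
    IsAbelianBorder x (i + 1) (abArray x (i + 1)) :=
  Nat.sSup_mem (s := {k | IsAbelianBorder x (i + 1) k})
    ⟨0, Nat.succ_pos i, by simp [onesIn]⟩ ⟨i + 1, fun _ hk => hk.1.le⟩

/-- The last letter of a prefix agrees with the first letter exactly when the longest abelian
border of that prefix has the maximal possible length. -/
theorem abArray_succ_eq_iff (x : ℕ → Bool) (i : ℕ) :
    abArray x (i + 1) = i ↔ x 0 = x i := by
  rw [← isAbelianBorder_succ_self_iff]
  have hb := isAbelianBorder_abArray_succ x i
  refine ⟨fun h => by rwa [h] at hb, fun h => le_antisymm (Nat.lt_succ_iff.mp hb.1) ?_⟩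
  exact le_csSup (s := {k | IsAbelianBorder x (i + 1) k}) ⟨i + 1, fun _ hk => hk.1.le⟩ h

theorem abVec_not {n : ℕ} (x : Fin n → Bool) : abVec (fun i => !x i) = abVec x := by
  funext i
  refine (abArray_eq_of_eq_not fun j hj => ?_).symm
  have hjn : j < n := by omega
  simp [hjn]

theorem abVec_eq_iff_letter {n : ℕ} (hn : 1 ≤ n) (x : Fin n → Bool) (i : Fin n) :
    abVec x i = i.1 ↔ x ⟨0, hn⟩ = x i := by
  have hn' : 0 < n := hn
  rw [abVec, abArray_succ_eq_iff]
  simp [hn']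

theorem eq_of_abVec_eq {n : ℕ} (hn : 1 ≤ n) {x y : Fin n → Bool} (h : abVec x = abVec y)
    (h0 : x ⟨0, hn⟩ = y ⟨0, hn⟩) : x = y := by
  funext i
  have hx := abVec_eq_iff_letter hn x i
  rw [h, abVec_eq_iff_letter hn y i, h0] at hx
  revert hx
  cases x i <;> cases y i <;> cases y ⟨0, hn⟩ <;> simp

theorem abVec_eq_abVec_iff {n : ℕ} (hn : 1 ≤ n) {x y : Fin n → Bool} :
    abVec y = abVec x ↔ y = x ∨ y = fun i => !x i := by
  refine ⟨fun h => ?_, ?_⟩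
  · by_cases h0 : y ⟨0, hn⟩ = x ⟨0, hn⟩
    · exact Or.inl (eq_of_abVec_eq hn h h0)
    · exact Or.inr (eq_of_abVec_eq hn (h.trans (abVec_not x).symm) (Bool.eq_not.mpr h0))
  · rintro (rfl | rfl)
    · rfl
    · exact abVec_not x

/-- A binary word and its complement have the same abelian border array.  Consequently,
every valid abelian border array `π` of length `n ≥ 1` has exactly two generating words,
which are complements of each other, and a unique generating word starting with `0`. -/
theorem stmt_1 (n : ℕ) (hn : 1 ≤ n) :
    (∀ m : ℕ, ∀ x : Fin m → Bool, abVec x = abVec (fun i => !x i)) ∧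
    ∀ π : Fin n → ℕ, (∃ x : Fin n → Bool, abVec x = π) →
      (∃ x : Fin n → Bool,
        {y : Fin n → Bool | abVec y = π} = {x, fun i => !x i} ∧ x ≠ fun i => !x i) ∧
      (∃! z : Fin n → Bool, abVec z = π ∧ z ⟨0, hn⟩ = false) := by
  refine ⟨fun m x => (abVec_not x).symm, ?_⟩
  rintro π ⟨x, rfl⟩
  refine ⟨⟨x, ?_, ?_⟩, ?_⟩
  · ext y
    exact abVec_eq_abVec_iff hn
  · intro h
    simpa using congrFun h ⟨0, hn⟩
  · refine existsUnique_of_exists_of_unique ?_ fun y z hy hz =>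
      eq_of_abVec_eq hn (hy.1.trans hz.1.symm) (hy.2.trans hz.2.symm)
    cases h0 : x ⟨0, hn⟩
    · exact ⟨x, rfl, h0⟩
    · exact ⟨fun i => !x i, abVec_not x, by simp [h0]⟩
end

section
/- Let x be a binary word of length n with x[1] = 0. For every 1 < i ≤ n, if x[i] = 1 then π_x[i] ≤ π_x[i−1]. -/
theorem onesIn_zero_succ (x : ℕ → Bool) (j : ℕ) :
    onesIn x 0 (j + 1) = onesIn x 0 j + if x j = true then 1 else 0 := by
  simp only [onesIn, Finset.card_filter]
  exact Finset.sum_Ico_succ_top (Nat.zero_le j) _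

theorem onesIn_add_onesIn (x : ℕ → Bool) {a b : ℕ} (h : a ≤ b) :
    onesIn x 0 a + onesIn x a b = onesIn x 0 b := by
  simp only [onesIn, Finset.card_filter]
  exact Finset.sum_Ico_consecutive _ (Nat.zero_le a) h

theorem isAbelianBorder_iff (x : ℕ → Bool) (m k : ℕ) :
    IsAbelianBorder x m k ↔
      k < m ∧ onesIn x 0 k + onesIn x 0 (m - k) = onesIn x 0 m := by
  have h := onesIn_add_onesIn x (Nat.sub_le m k)
  unfold IsAbelianBorder
  omega

/-- Discrete intermediate value argument: the excess `ones(prefix k) - ones(suffix k)` changes by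
at most one when `k` grows by one, and is nonpositive at `k = m - 1` when `x` starts with `0`. -/
theorem exists_isAbelianBorder_ge (x : ℕ → Bool) (hx : x 0 = false) (m d k : ℕ)
    (hk : k + d + 1 = m) (h : onesIn x 0 m ≤ onesIn x 0 k + onesIn x 0 (m - k)) :
    ∃ j, k ≤ j ∧ IsAbelianBorder x m j := by
  induction d generalizing k with
  | zero =>
    refine ⟨k, le_rfl, (isAbelianBorder_iff x m k).2 ⟨by omega, ?_⟩⟩
    subst hk
    have h1 : onesIn x 0 1 = 0 := by simp [onesIn, hx]
    have h2 := onesIn_zero_succ x k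
    simp only [add_zero, Nat.add_sub_cancel_left] at h ⊢
    omega
  | succ d ih =>
    by_cases he : onesIn x 0 k + onesIn x 0 (m - k) = onesIn x 0 m
    · exact ⟨k, le_rfl, (isAbelianBorder_iff x m k).2 ⟨by omega, he⟩⟩
    · have h1 := onesIn_zero_succ x k
      have h2 := onesIn_zero_succ x (m - (k + 1))
      rw [show m - (k + 1) + 1 = m - k by omega] at h2
      have h3 : (if x (m - (k + 1)) = true then 1 else 0) ≤ 1 := by split <;> simp
      obtain ⟨j, hj, hb⟩ := ih (k + 1) (by omega) (by omega)
      exact ⟨j, by omega, hb⟩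

theorem le_abArray {x : ℕ → Bool} {m k : ℕ} (h : IsAbelianBorder x m k) :
    k ≤ abArray x m :=
  le_csSup ⟨m, fun _ hj => hj.1.le⟩ h

/-- For a binary word `x` of length `n` with `x[1] = 0` and `1 < i ≤ n`:
if `x[i] = 1` then `π_x[i] ≤ π_x[i-1]`. -/
theorem stmt_9 (n : ℕ) (x : ℕ → Bool) (hx1 : x 0 = false) (i : ℕ)
    (h1 : 1 < i) (hin : i ≤ n) (hxi : x (i - 1) = true) :
    abArray x i ≤ abArray x (i - 1) := by
  refine csSup_le ⟨0, by omega, by simp [onesIn]⟩ fun k hk => ?_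
  obtain ⟨hki, hk⟩ := (isAbelianBorder_iff x i k).1 hk
  obtain ⟨m, rfl⟩ : ∃ m, i = m + 1 := ⟨i - 1, by omega⟩
  simp only [Nat.add_sub_cancel] at hxi ⊢
  have hm := onesIn_zero_succ x m
  rw [hxi, if_pos rfl] at hm
  have hkm : k ≠ m := by
    rintro rfl
    have h0 : onesIn x 0 1 = 0 := by simp [onesIn, hx1]
    rw [Nat.add_sub_cancel_left] at hk
    omega
  have h2 := onesIn_zero_succ x (m - k)
  rw [show m - k + 1 = m + 1 - k by omega] at h2
  have h3 : (if x (m - k) = true then 1 else 0) ≤ 1 := by split <;> simp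
  obtain ⟨j, hj, hb⟩ :=
    exists_isAbelianBorder_ge x hx1 m (m - k - 1) k (by omega) (by omega)
  exact hj.trans (le_abArray hb)
end

section
/- Let π be an integer array of length n, and define the binary word x_π of length n by x_π[i] = 0 if π[i] = i − 1 and x_π[i] = 1 otherwise. If π is a valid abelian border array, then π equals the abelian border array of x_π, i.e., π = π_{x_π}. -/
theorem onesIn_congr {x y : ℕ → Bool} {a b : ℕ} (h : ∀ i < b, x i = y i) :
    onesIn x a b = onesIn y a b := by
  unfold onesIn
  congr 1
  refine Finset.filter_congr fun i hi => ?_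
  rw [h i (Finset.mem_Ico.mp hi).2]

theorem onesIn_add_onesIn_not (x : ℕ → Bool) (a b : ℕ) :
    onesIn x a b + onesIn (fun i => !x i) a b = b - a := by
  have h := Finset.card_filter_add_card_filter_not (s := Finset.Ico a b) (fun i => x i = true)
  simpa [onesIn] using h

theorem isAbelianBorder_congr {x y : ℕ → Bool} {m : ℕ} (h : ∀ i < m, x i = y i) (k : ℕ) :
    IsAbelianBorder x m k ↔ IsAbelianBorder y m k := by
  refine and_congr_right fun hk => ?_
  rw [onesIn_congr h, onesIn_congr fun i hi => h i (hi.trans hk)]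

theorem isAbelianBorder_not (x : ℕ → Bool) (m k : ℕ) :
    IsAbelianBorder (fun i => !x i) m k ↔ IsAbelianBorder x m k := by
  refine and_congr_right fun hk => ?_
  have h₁ := onesIn_add_onesIn_not x 0 k
  have h₂ := onesIn_add_onesIn_not x (m - k) m
  omega

theorem abArray_congr {x y : ℕ → Bool} {m : ℕ} (h : ∀ i < m, x i = y i) :
    abArray x m = abArray y m := by
  simp only [abArray, isAbelianBorder_congr h]

theorem abArray_not (x : ℕ → Bool) (m : ℕ) : abArray (fun i => !x i) m = abArray x m := by
  simp only [abArray, isAbelianBorder_not]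

theorem abArray_xor (x : ℕ → Bool) (c : Bool) (m : ℕ) :
    abArray (fun i => x i ^^ c) m = abArray x m := by
  cases c
  · simp
  · simpa using abArray_not x m

theorem isAbelianBorder_abArray (x : ℕ → Bool) {m : ℕ} (hm : 0 < m) :
    IsAbelianBorder x m (abArray x m) :=
  Nat.sSup_mem (s := {k | IsAbelianBorder x m k}) ⟨0, hm, by simp [onesIn]⟩
    ⟨m, fun _ hk => hk.1.le⟩

theorem isAbelianBorder_succ_self (x : ℕ → Bool) (i : ℕ) :
    IsAbelianBorder x (i + 1) i ↔ x i = x 0 := by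
  have h₁ := Finset.sum_Ico_succ_top (Nat.zero_le i) fun j => if x j = true then 1 else 0
  have h₂ := Finset.sum_eq_sum_Ico_succ_bot (Nat.succ_pos i) fun j => if x j = true then 1 else 0
  simp only [IsAbelianBorder, onesIn, Finset.card_filter, Nat.add_sub_cancel_left]
  cases h : x i <;> cases h' : x 0 <;> simp [h, h'] at h₁ h₂ ⊢ <;> omega

theorem abArray_succ_eq_self (x : ℕ → Bool) (i : ℕ) : abArray x (i + 1) = i ↔ x i = x 0 := by
  have hb := isAbelianBorder_abArray x (Nat.succ_pos i)
  rw [← isAbelianBorder_succ_self]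
  refine ⟨fun h => ?_, fun h => le_antisymm (Nat.lt_succ_iff.mp hb.1) (le_abArray h)⟩
  rwa [Nat.succ_eq_add_one, h] at hb

/-- For an array `π` of length `n`, let `x_π` be the binary word with `x_π[i] = 0`
iff `π[i] = i - 1`.  If `π` is a valid abelian border array, then `π = π_{x_π}`. -/
theorem stmt_11 (n : ℕ) (π : Fin n → ℕ)
    (hvalid : ∃ x : Fin n → Bool, abVec x = π) :
    abVec (fun i : Fin n => if π i = i.1 then false else true) = π := by
  obtain ⟨x, rfl⟩ := hvalid
  funext i
  set X : ℕ → Bool := fun j => if h : j < n then x ⟨j, h⟩ else false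
  have hx : ∀ j, abVec x j = abArray X (j.1 + 1) := fun j => rfl
  rw [hx, ← abArray_xor X (X 0)]
  refine abArray_congr fun j hj => ?_
  have hjn : j < n := by omega
  simp only [hjn, dif_pos, hx, abArray_succ_eq_self]
  cases X j <;> cases X 0 <;> rfl
end

section
/- Let x be a binary word of length n with x[1] = 0, let 1 < i ≤ n, and let k be the length of the shortest non-empty abelian border of x[1⋯i−1] (when one exists). If x[i] = 1, then for every 1 ≤ j < k, ones(x[1⋯j]) < ones(x[i−j+1⋯i]); in particular, x[1⋯i] has no abelian border of any length j with 1 ≤ j < k. -/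
theorem onesIn_succ_right (x : ℕ → Bool) {a b : ℕ} (h : a ≤ b) :
    onesIn x a (b + 1) = onesIn x a b + (x b).toNat := by
  unfold onesIn
  rw [← Finset.insert_Ico_right_eq_Ico_add_one h, Finset.filter_insert]
  cases hb : x b <;> simp

theorem onesIn_eq_add_onesIn_succ (x : ℕ → Bool) {a b : ℕ} (h : a < b) :
    onesIn x a b = (x a).toNat + onesIn x (a + 1) b := by
  unfold onesIn
  rw [← Finset.insert_Ico_add_one_left_eq_Ico h, Finset.filter_insert]
  cases ha : x a <;> simp [add_comm]

theorem onesIn_self (x : ℕ → Bool) (a : ℕ) : onesIn x a a = 0 := by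
  simp [onesIn]

/-- If the word `x[0..m-1]` starts with `0` and has no non-empty abelian border shorter
than `k`, then each of its shorter non-empty prefixes has fewer ones than the suffix of the
same length. -/
theorem onesIn_prefix_lt_suffix {x : ℕ → Bool} {m k : ℕ} (hx : x 0 = false) (hkm : k ≤ m)
    (hmin : ∀ j, 1 ≤ j → j < k → ¬ IsAbelianBorder x m j) :
    ∀ j, 1 ≤ j → j < k → onesIn x 0 j < onesIn x (m - j) m := by
  intro j hj
  induction j, hj using Nat.le_induction with
  | base =>
    intro hk
    have hne : onesIn x 0 1 ≠ onesIn x (m - 1) m :=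
      fun h => hmin 1 le_rfl hk ⟨by omega, h⟩
    have hzero : onesIn x 0 1 = 0 := by
      simp [onesIn_succ_right x le_rfl, onesIn_self, hx]
    omega
  | succ j hj ih =>
    intro hk
    have hlt := ih (by omega)
    have hne : onesIn x 0 (j + 1) ≠ onesIn x (m - (j + 1)) m :=
      fun h => hmin (j + 1) (by omega) hk ⟨by omega, h⟩
    have hprefix := onesIn_succ_right x (Nat.zero_le j)
    have hsuffix := onesIn_eq_add_onesIn_succ x (show m - (j + 1) < m by omega)
    rw [show m - (j + 1) + 1 = m - j by omega] at hsuffix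
    have hbit := Bool.toNat_le (x j)
    omega

/-- Let `x` be a binary word of length `n` with `x[1] = 0`, let `1 < i ≤ n`, and let
`k` be the length of the shortest non-empty abelian border of `x[1..i-1]` (when one
exists).  If `x[i] = 1`, then for every `1 ≤ j < k` the number of ones of `x[1..j]` is
strictly less than that of `x[i-j+1..i]`; in particular `x[1..i]` has no abelian border
of any length `j` with `1 ≤ j < k`. -/
theorem stmt_17 (n : ℕ) (x : ℕ → Bool) (hx1 : x 0 = false) (i k : ℕ)
    (h1 : 1 < i) (hin : i ≤ n)
    (hk : 0 < k ∧ IsAbelianBorder x (i - 1) k)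
    (hks : sInf {j | 0 < j ∧ IsAbelianBorder x (i - 1) j} = k)
    (hxi : x (i - 1) = true) :
    ∀ j, 1 ≤ j → j < k →
      onesIn x 0 j < onesIn x (i - j) i ∧ ¬ IsAbelianBorder x i j := by
  obtain ⟨m, rfl⟩ : ∃ m, i = m + 1 := ⟨i - 1, by omega⟩
  rw [Nat.add_sub_cancel] at hk hks hxi
  have hmin : ∀ j, 1 ≤ j → j < k → ¬ IsAbelianBorder x m j :=
    fun j hj hjk hb => Nat.notMem_of_lt_sInf (hjk.trans_eq hks.symm) ⟨hj, hb⟩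
  have hkm : k < m := hk.2.1
  intro j hj hjk
  suffices hlt : onesIn x 0 j < onesIn x (m + 1 - j) (m + 1) from
    ⟨hlt, fun hb => hlt.ne hb.2⟩
  obtain ⟨l, rfl⟩ : ∃ l, j = l + 1 := ⟨j - 1, by omega⟩
  rw [Nat.add_sub_add_right, onesIn_succ_right x (Nat.sub_le m l),
    onesIn_succ_right x (Nat.zero_le l), hxi, Bool.toNat_true]
  rcases Nat.eq_zero_or_pos l with rfl | hl
  · simp [onesIn_self, hx1]
  · have hlt := onesIn_prefix_lt_suffix hx1 hkm.le hmin l hl (by omega)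
    have hbit := Bool.toNat_le (x l)
    omega
end
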